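/- The flipped generalized polynomial ring S = R[X;σ,δ]^fl is associative if and only if R is associative and commutative, σ is a ring endomorphism of R, and δ is a left σ-derivation (δ(rs) = σ(r)δ(s) + δ(r)s for all r, s ∈ R). -/

import Mathlib

/-- The π-functions `piFun σ δ m i = π_i^m`. -/
def piFun {R : Type*} [NonAssocRing R] (σ δ : R → R) : ℕ → ℕ → R → R
  | 0, 0, r => r
  | 0, _+1, _ => 0
  | m+1, 0, r => δ (piFun σ δ m 0 r)
  | m+1, i+1, r => σ (piFun σ δ m i r) + δ (piFun σ δ m (i+1) r)

/-- `tau n r s = rs` if `n` is even and `sr` if `n` is odd. -/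
def tau {R : Type*} [NonAssocRing R] (n : ℕ) (r s : R) : R :=
  if Even n then r * s else s * r

/-- The multiplication of the flipped generalized polynomial ring `R[X;σ,δ]^fl`:
the biadditive extension of `(rX^m)(sX^n) = Σ_i τ_n(r, π_i^m(s)) X^{i+n}`. Polynomials
are represented as finitely supported functions `ℕ →₀ R`. -/
noncomputable def flipMul {R : Type*} [NonAssocRing R] (σ δ : R → R) (p q : ℕ →₀ R) : ℕ →₀ R :=
  p.sum fun m r => q.sum fun n s =>
    ∑ i ∈ Finset.range (m+1), Finsupp.single (i+n) (tau n r (piFun σ δ m i s))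

section FlippedPolynomial

variable {R : Type*} [NonAssocRing R]

lemma piFun_zero_right (σ δ : R →+ R) (m i : ℕ) : piFun σ δ m i 0 = 0 := by
  induction m generalizing i with
  | zero => cases i <;> rfl
  | succ m ih => cases i <;> simp [piFun, ih]

lemma piFun_eq_zero_of_lt (σ δ : R →+ R) {m i : ℕ} (h : m < i) (r : R) :
    piFun σ δ m i r = 0 := by
  induction m generalizing i with
  | zero =>
    cases i with
    | zero => omega
    | succ i => rfl
  | succ m ih =>
    cases i with
    | zero => omega
    | succ i => simp [piFun, ih (show m < i by omega), ih (show m < i + 1 by omega)]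

@[simp] lemma tau_zero_left (n : ℕ) (s : R) : tau n 0 s = 0 := by simp [tau]

@[simp] lemma tau_zero_right (n : ℕ) (r : R) : tau n r 0 = 0 := by simp [tau]

lemma tau_eq_mul (hcomm : ∀ r s : R, r * s = s * r) (n : ℕ) (r s : R) : tau n r s = r * s := by
  unfold tau
  split_ifs
  · rfl
  · exact hcomm s r

lemma flipMul_single_single (σ δ : R →+ R) (m n : ℕ) (r s : R) :
    flipMul σ δ (Finsupp.single m r) (Finsupp.single n s) =
      ∑ i ∈ Finset.range (m + 1), Finsupp.single (i + n) (tau n r (piFun σ δ m i s)) := by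
  unfold flipMul
  rw [Finsupp.sum_single_index (by simp), Finsupp.sum_single_index (by simp [piFun_zero_right])]

/-- Multiplication of all coefficients from the left by a constant. -/
noncomputable def coeffMul : R →+ (ℕ →₀ R) →+ (ℕ →₀ R) :=
  AddMonoidHom.mk' (fun r => Finsupp.mapRange.addMonoidHom (AddMonoidHom.mulLeft r)) fun r s => by
    ext; simp [add_mul]

@[simp] lemma coeffMul_single (r s : R) (n : ℕ) :
    coeffMul r (Finsupp.single n s) = Finsupp.single n (r * s) := by
  simp [coeffMul]

/-- Left multiplication by the indeterminate: `sXⁿ ↦ σ(s)Xⁿ⁺¹ + δ(s)Xⁿ`. -/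
noncomputable def indetMul (σ δ : R →+ R) : (ℕ →₀ R) →+ (ℕ →₀ R) :=
  Finsupp.liftAddHom fun n =>
    (Finsupp.singleAddHom (n + 1)).comp σ + (Finsupp.singleAddHom n).comp δ

@[simp] lemma indetMul_single (σ δ : R →+ R) (n : ℕ) (s : R) :
    indetMul σ δ (Finsupp.single n s) =
      Finsupp.single (n + 1) (σ s) + Finsupp.single n (δ s) :=
  Finsupp.liftAddHom_apply_single _ _ _

/-- The `m`-fold iterate of `indetMul σ δ`. -/
noncomputable def indetPow (σ δ : R →+ R) : ℕ → (ℕ →₀ R) →+ (ℕ →₀ R)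
  | 0 => AddMonoidHom.id _
  | m + 1 => (indetMul σ δ).comp (indetPow σ δ m)

lemma indetPow_single (σ δ : R →+ R) (m n : ℕ) (s : R) :
    indetPow σ δ m (Finsupp.single n s) =
      ∑ i ∈ Finset.range (m + 1), Finsupp.single (i + n) (piFun σ δ m i s) := by
  induction m with
  | zero => simp [indetPow, piFun]
  | succ m ih =>
    rw [indetPow, AddMonoidHom.comp_apply, ih, map_sum]
    simp only [indetMul_single, Finset.sum_add_distrib]
    rw [Finset.sum_range_succ' _ (m + 1), Finset.sum_range_succ' (fun i =>
      Finsupp.single (i + n) (δ (piFun σ δ m i s))) m]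
    simp only [piFun, Finsupp.single_add, Finset.sum_add_distrib]
    rw [Finset.sum_range_succ (fun i => Finsupp.single (i + 1 + n) (δ (piFun σ δ m (i + 1) s))) m,
      piFun_eq_zero_of_lt σ δ (Nat.lt_succ_self m)]
    simp [add_assoc, add_comm, add_left_comm]

/-- The multiplication `(rXᵐ) q = r · (X · (⋯ (X · q)))` without flips, as a biadditive map. -/
noncomputable def polyMul (σ δ : R →+ R) : (ℕ →₀ R) →+ (ℕ →₀ R) →+ (ℕ →₀ R) :=
  Finsupp.liftAddHom fun m =>
    AddMonoidHom.mk' (fun r => (coeffMul r).comp (indetPow σ δ m)) fun r s => by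
      rw [map_add]; rfl

@[simp] lemma polyMul_single (σ δ : R →+ R) (m : ℕ) (r : R) (q : ℕ →₀ R) :
    polyMul σ δ (Finsupp.single m r) q = coeffMul r (indetPow σ δ m q) := by
  rw [polyMul, Finsupp.liftAddHom_apply_single]
  rfl

lemma polyMul_apply (σ δ : R →+ R) (p q : ℕ →₀ R) :
    polyMul σ δ p q = p.sum fun m r => coeffMul r (indetPow σ δ m q) := by
  conv_lhs => rw [← p.sum_single]
  simp [Finsupp.sum]

lemma flipMul_eq_polyMul (σ δ : R →+ R) (hcomm : ∀ r s : R, r * s = s * r) (p q : ℕ →₀ R) :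
    flipMul σ δ p q = polyMul σ δ p q := by
  rw [polyMul_apply, flipMul]
  refine Finsupp.sum_congr fun m _ => ?_
  conv_rhs => rw [← q.sum_single]
  simp [-Finsupp.single_mul, Finsupp.sum, indetPow_single, tau_eq_mul hcomm]

lemma coeffMul_mul (hassoc : ∀ r s t : R, (r * s) * t = r * (s * t)) (r s : R) (q : ℕ →₀ R) :
    coeffMul (r * s) q = coeffMul r (coeffMul s q) := by
  induction q using Finsupp.induction_linear with
  | zero => simp
  | add p q hp hq => simp [hp, hq]
  | single n t => simp [-Finsupp.single_mul, hassoc]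

lemma indetMul_coeffMul (σ δ : R →+ R) (hσ : ∀ r s : R, σ (r * s) = σ r * σ s)
    (hδ : ∀ r s : R, δ (r * s) = σ r * δ s + δ r * s) (r : R) (q : ℕ →₀ R) :
    indetMul σ δ (coeffMul r q) = coeffMul (σ r) (indetMul σ δ q) + coeffMul (δ r) q := by
  induction q using Finsupp.induction_linear with
  | zero => simp
  | add p q hp hq => simp only [map_add, hp, hq]; abel
  | single n t => simp [-Finsupp.single_mul, hσ, hδ, add_assoc]

lemma coeffMul_polyMul (σ δ : R →+ R) (hassoc : ∀ r s t : R, (r * s) * t = r * (s * t))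
    (r : R) (p q : ℕ →₀ R) :
    polyMul σ δ (coeffMul r p) q = coeffMul r (polyMul σ δ p q) := by
  induction p using Finsupp.induction_linear with
  | zero => simp
  | add p p' hp hp' => simp [hp, hp']
  | single n t => simp [-Finsupp.single_mul, coeffMul_mul hassoc]

lemma indetMul_polyMul (σ δ : R →+ R) (hσ : ∀ r s : R, σ (r * s) = σ r * σ s)
    (hδ : ∀ r s : R, δ (r * s) = σ r * δ s + δ r * s) (p q : ℕ →₀ R) :
    polyMul σ δ (indetMul σ δ p) q = indetMul σ δ (polyMul σ δ p q) := by
  induction p using Finsupp.induction_linear with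
  | zero => simp
  | add p p' hp hp' => simp [hp, hp']
  | single n t => simp [-Finsupp.single_mul, indetMul_coeffMul σ δ hσ hδ, indetPow]

lemma indetPow_polyMul (σ δ : R →+ R) (hσ : ∀ r s : R, σ (r * s) = σ r * σ s)
    (hδ : ∀ r s : R, δ (r * s) = σ r * δ s + δ r * s) (m : ℕ) (p q : ℕ →₀ R) :
    polyMul σ δ (indetPow σ δ m p) q = indetPow σ δ m (polyMul σ δ p q) := by
  induction m with
  | zero => simp [indetPow]
  | succ m ih => simp [indetPow, indetMul_polyMul σ δ hσ hδ, ih]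

lemma polyMul_assoc (σ δ : R →+ R) (hassoc : ∀ r s t : R, (r * s) * t = r * (s * t))
    (hσ : ∀ r s : R, σ (r * s) = σ r * σ s)
    (hδ : ∀ r s : R, δ (r * s) = σ r * δ s + δ r * s) (p q w : ℕ →₀ R) :
    polyMul σ δ (polyMul σ δ p q) w = polyMul σ δ p (polyMul σ δ q w) := by
  induction p using Finsupp.induction_linear with
  | zero => simp
  | add p p' hp hp' => simp [hp, hp']
  | single n t =>
    simp [-Finsupp.single_mul, coeffMul_polyMul σ δ hassoc, indetPow_polyMul σ δ hσ hδ]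

end FlippedPolynomial

/-- `S = R[X;σ,δ]^fl` is associative if and only if `R` is associative and
commutative, `σ` is a ring endomorphism of `R`, and `δ` is a left `σ`-derivation. -/
theorem flipped_generalized_polynomial_ring_associative_iff {R : Type*} [NonAssocRing R]
    (σ δ : R →+ R) (hσ : σ 1 = 1) (hδ : δ 1 = 0) :
    (∀ p q w : ℕ →₀ R,
      flipMul (σ : R → R) (δ : R → R) (flipMul (σ : R → R) (δ : R → R) p q) w
        = flipMul (σ : R → R) (δ : R → R) p (flipMul (σ : R → R) (δ : R → R) q w)) ↔
    ((∀ r s t : R, (r * s) * t = r * (s * t)) ∧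
     (∀ r s : R, r * s = s * r) ∧
     (∀ r s : R, σ (r * s) = σ r * σ s) ∧
     (∀ r s : R, δ (r * s) = σ r * δ s + δ r * s)) := by
  constructor
  · intro h
    have hassoc (r s t : R) : (r * s) * t = r * (s * t) := by
      have := h (.single 0 r) (.single 0 s) (.single 0 t)
      refine Finsupp.single_injective 0 ?_
      simpa [-Finsupp.single_mul, flipMul_single_single, tau, piFun] using this
    have hcomm (r s : R) : r * s = s * r := by
      have := h (.single 0 r) (.single 0 s) (.single 1 1)
      refine Finsupp.single_injective 1 ?_
      simpa [-Finsupp.single_mul, flipMul_single_single, tau, piFun] using this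
    have key (r s : R) := h (.single 1 1) (.single 0 r) (.single 0 s)
    simp only [flipMul_eq_polyMul σ δ hcomm] at key
    refine ⟨hassoc, hcomm, fun r s => ?_, fun r s => ?_⟩
    · simpa [-Finsupp.single_mul, indetPow] using (DFunLike.congr_fun (key r s) 1).symm
    · simpa [-Finsupp.single_mul, indetPow] using (DFunLike.congr_fun (key r s) 0).symm
  · rintro ⟨hassoc, hcomm, hσ', hδ'⟩ p q w
    simp only [flipMul_eq_polyMul σ δ hcomm]
    exact polyMul_assoc σ δ hassoc hσ' hδ' p q w
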